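/- Suppose the projective limit of simplices satisfies: for every m : ℕ, the set of all images of vertices of later levels, { π[n,m] (e v) | n ≥ m, v : V n }, is dense in stdSimplex ℝ (V m). Then the set of extreme points of Σ∞ is dense in Σ∞ (so Σ∞ is a Poulsen simplex). -/

import Mathlib

open scoped BigOperators

/-- The one-step affine projection induced by the cotransition probabilities `lam`:
`(π n x) u = ∑ v, lam n v u * x v`. -/
def projStep (V : ℕ → Type) [∀ n, Fintype (V n)]
    (lam : ∀ n, V (n + 1) → V n → ℝ) (n : ℕ) (x : V (n + 1) → ℝ) : V n → ℝ :=
  fun u => ∑ v, lam n v u * x v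

/-- The iterated projection `π[n,m] = π m ∘ ⋯ ∘ π (n-1)` for `m ≤ n` (with `π[n,n] = id`). -/
def projIter (V : ℕ → Type) [∀ n, Fintype (V n)]
    (lam : ∀ n, V (n + 1) → V n → ℝ) {m n : ℕ} (h : m ≤ n) :
    (V n → ℝ) → V m → ℝ :=
  Nat.leRecOn (C := fun k => (V k → ℝ) → V m → ℝ) h
    (fun {k} f x => f (projStep V lam k x)) id

/-- The projective limit `Σ∞`. -/
def SigmaInf (V : ℕ → Type) [∀ n, Fintype (V n)]
    (lam : ∀ n, V (n + 1) → V n → ℝ) : Set (∀ n, V n → ℝ) :=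
  {x | (∀ n, x n ∈ stdSimplex ℝ (V n)) ∧ ∀ n, projStep V lam n (x (n + 1)) = x n}

/-- The vertex `e v` of the simplex `stdSimplex ℝ (V n)`: the indicator function of `v`. -/
def vert (V : ℕ → Type) [∀ n, DecidableEq (V n)] {n : ℕ} (v : V n) : V n → ℝ :=
  fun u => if u = v then 1 else 0

section Helpers

variable (V : ℕ → Type) [∀ n, Fintype (V n)] (lam : ∀ n, V (n + 1) → V n → ℝ)

/-- The `ℓ¹` distance. -/
def dOne {α : Type} [Fintype α] (x y : α → ℝ) : ℝ := ∑ u, |x u - y u|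

lemma dOne_comm {α : Type} [Fintype α] (x y : α → ℝ) : dOne x y = dOne y x := by
  unfold dOne
  exact Finset.sum_congr rfl fun u _ => abs_sub_comm _ _

lemma dOne_self {α : Type} [Fintype α] (x : α → ℝ) : dOne x x = 0 := by
  simp [dOne]

lemma dOne_nonneg {α : Type} [Fintype α] (x y : α → ℝ) : 0 ≤ dOne x y :=
  Finset.sum_nonneg fun _ _ => abs_nonneg _

lemma dOne_triangle {α : Type} [Fintype α] (x y z : α → ℝ) :
    dOne x z ≤ dOne x y + dOne y z := by
  unfold dOne
  rw [← Finset.sum_add_distrib]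
  exact Finset.sum_le_sum fun u _ => abs_sub_le _ _ _

lemma abs_le_dOne {α : Type} [Fintype α] (x y : α → ℝ) (u : α) : |x u - y u| ≤ dOne x y :=
  Finset.single_le_sum (f := fun u => |x u - y u|) (fun _ _ => abs_nonneg _) (Finset.mem_univ u)

lemma dOne_continuous {α : Type} [Fintype α] (y : α → ℝ) :
    Continuous fun x : α → ℝ => dOne x y := by
  unfold dOne
  fun_prop

lemma dOne_close {α : Type} [Fintype α] {S : Set (α → ℝ)} {x : α → ℝ} (hx : x ∈ closure S)
    {ε : ℝ} (hε : 0 < ε) : ∃ y ∈ S, dOne y x < ε := by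
  have ho : IsOpen {y : α → ℝ | dOne y x < ε} := isOpen_lt (dOne_continuous x) continuous_const
  obtain ⟨y, hy, hyS⟩ := mem_closure_iff.1 hx _ ho (by simpa [dOne_self] using hε)
  exact ⟨y, hyS, hy⟩

lemma projIter_self (m : ℕ) (x : V m → ℝ) : projIter V lam (le_refl m) x = x := by
  unfold projIter
  rw [Nat.leRecOn_self]; rfl

lemma projIter_succ {m n : ℕ} (h : m ≤ n) (h' : m ≤ n + 1) (x : V (n + 1) → ℝ) :
    projIter V lam h' x = projIter V lam h (projStep V lam n x) := by
  unfold projIter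
  rw [Nat.leRecOn_succ h]

lemma projIter_trans {m n k : ℕ} (h : m ≤ n) (h' : n ≤ k) (x : V k → ℝ) :
    projIter V lam (h.trans h') x = projIter V lam h (projIter V lam h' x) := by
  induction k, h' using Nat.le_induction with
  | base => rw [projIter_self]
  | succ k hk ih => rw [projIter_succ V lam (h.trans hk), projIter_succ V lam hk, ih]

lemma projIter_step {j n : ℕ} (h : j + 1 ≤ n) (x : V n → ℝ) :
    projStep V lam j (projIter V lam h x) = projIter V lam ((Nat.le_succ j).trans h) x := by
  rw [projIter_trans V lam (Nat.le_succ j) h, projIter_succ V lam (le_refl j), projIter_self]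

lemma projIter_sigma {y : ∀ n, V n → ℝ} (hy : y ∈ SigmaInf V lam) {m n : ℕ} (h : m ≤ n) :
    projIter V lam h (y n) = y m := by
  induction n, h using Nat.le_induction with
  | base => rw [projIter_self]
  | succ k hk ih => rw [projIter_succ V lam hk, hy.2, ih]

lemma projStep_dOne
    (hpos : ∀ n (v : V (n + 1)) (u : V n), 0 ≤ lam n v u)
    (hsum : ∀ n (v : V (n + 1)), ∑ u, lam n v u = 1)
    (n : ℕ) (x y : V (n + 1) → ℝ) :
    dOne (projStep V lam n x) (projStep V lam n y) ≤ dOne x y := by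
  unfold dOne projStep
  calc ∑ u, |∑ v, lam n v u * x v - ∑ v, lam n v u * y v|
      ≤ ∑ u, ∑ v, lam n v u * |x v - y v| := by
        refine Finset.sum_le_sum fun u _ => ?_
        rw [← Finset.sum_sub_distrib]
        refine (Finset.abs_sum_le_sum_abs _ _).trans (Finset.sum_le_sum fun v _ => ?_)
        rw [← mul_sub, abs_mul, abs_of_nonneg (hpos n v u)]
    _ = ∑ v, |x v - y v| := by
        rw [Finset.sum_comm]
        refine Finset.sum_congr rfl fun v _ => ?_
        rw [← Finset.sum_mul, hsum, one_mul]

lemma projIter_dOne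
    (hpos : ∀ n (v : V (n + 1)) (u : V n), 0 ≤ lam n v u)
    (hsum : ∀ n (v : V (n + 1)), ∑ u, lam n v u = 1)
    {m n : ℕ} (h : m ≤ n) (x y : V n → ℝ) :
    dOne (projIter V lam h x) (projIter V lam h y) ≤ dOne x y := by
  induction n, h using Nat.le_induction with
  | base => rw [projIter_self, projIter_self]
  | succ k hk ih =>
    rw [projIter_succ V lam hk, projIter_succ V lam hk]
    exact (ih _ _).trans (projStep_dOne V lam hpos hsum k x y)

lemma projStep_mem
    (hpos : ∀ n (v : V (n + 1)) (u : V n), 0 ≤ lam n v u)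
    (hsum : ∀ n (v : V (n + 1)), ∑ u, lam n v u = 1)
    (n : ℕ) {x : V (n + 1) → ℝ} (hx : x ∈ stdSimplex ℝ (V (n + 1))) :
    projStep V lam n x ∈ stdSimplex ℝ (V n) := by
  refine ⟨fun u => Finset.sum_nonneg fun v _ => mul_nonneg (hpos n v u) (hx.1 v), ?_⟩
  unfold projStep
  rw [Finset.sum_comm, ← hx.2]
  refine Finset.sum_congr rfl fun v _ => ?_
  rw [← Finset.sum_mul, hsum, one_mul]

lemma projIter_mem
    (hpos : ∀ n (v : V (n + 1)) (u : V n), 0 ≤ lam n v u)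
    (hsum : ∀ n (v : V (n + 1)), ∑ u, lam n v u = 1)
    {m n : ℕ} (h : m ≤ n) {x : V n → ℝ} (hx : x ∈ stdSimplex ℝ (V n)) :
    projIter V lam h x ∈ stdSimplex ℝ (V m) := by
  induction n, h using Nat.le_induction with
  | base => rwa [projIter_self]
  | succ k hk ih =>
    rw [projIter_succ V lam hk]
    exact ih (projStep_mem V lam hpos hsum k hx)

variable [∀ n, DecidableEq (V n)]

lemma vert_mem {n : ℕ} (v : V n) : vert V v ∈ stdSimplex ℝ (V n) := by
  refine ⟨fun u => ?_, by simp [vert]⟩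
  unfold vert
  split_ifs <;> norm_num

lemma dOne_vert {n : ℕ} (v : V n) {a : V n → ℝ} (ha : a ∈ stdSimplex ℝ (V n)) :
    dOne a (vert V v) = 2 * (1 - a v) := by
  have h1 : ∀ u, |a u - vert V v u| = a u + if u = v then 1 - 2 * a v else 0 := by
    intro u
    unfold vert
    split_ifs with h
    · subst h
      have : a u ≤ 1 := (mem_Icc_of_mem_stdSimplex ha u).2
      rw [abs_of_nonpos (by linarith)]; ring
    · rw [sub_zero, abs_of_nonneg (ha.1 u), add_zero]
  unfold dOne
  rw [Finset.sum_congr rfl fun u _ => h1 u, Finset.sum_add_distrib, ha.2]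
  simp
  ring

lemma later_vert
    (hpos : ∀ n (v : V (n + 1)) (u : V n), 0 ≤ lam n v u)
    (hsum : ∀ n (v : V (n + 1)), ∑ u, lam n v u = 1)
    [∀ n, Nonempty (V n)]
    (hdense : ∀ m : ℕ, stdSimplex ℝ (V m) ⊆
      closure {y : V m → ℝ | ∃ n, ∃ h : m ≤ n, ∃ v : V n, y = projIter V lam h (vert V v)})
    (m : ℕ) (v : V m) {ε : ℝ} (hε : 0 < ε) :
    ∃ n, ∃ h : m < n, ∃ w : V n, dOne (projIter V lam h.le (vert V w)) (vert V v) < ε := by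
  by_cases hc : ∃ w : V m, w ≠ v
  · obtain ⟨w, hw⟩ := hc
    set A : Set (V m → ℝ) :=
      {y | ∃ n, ∃ h : m < n, ∃ v : V n, y = projIter V lam h.le (vert V v)} with hA
    obtain ⟨t, ht0, ht1, htε⟩ : ∃ t : ℝ, 0 < t ∧ t < 1 ∧ 2 * t < ε / 2 := by
      refine ⟨min (1 / 2) (ε / 8), by positivity, ?_, ?_⟩
      · exact (min_le_left _ _).trans_lt (by norm_num)
      · have := min_le_right (1 / 2 : ℝ) (ε / 8)
        linarith
    set p : V m → ℝ := (1 - t) • vert V v + t • vert V w with hp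
    have hpm : p ∈ stdSimplex ℝ (V m) :=
      (convex_stdSimplex ℝ (V m)) (vert_mem V v) (vert_mem V w) (by linarith) ht0.le (by ring)
    have hpv : p v = 1 - t := by simp [hp, vert, hw.symm]
    have hpF : p ∉ Set.range (fun u : V m => vert V u) := by
      rintro ⟨u, hu⟩
      have h2 := congrFun hu v
      simp only [hpv] at h2
      unfold vert at h2
      split_ifs at h2 <;> linarith
    have hcl : p ∈ closure (A ∪ Set.range (fun u : V m => vert V u)) := by
      refine closure_mono ?_ (hdense m hpm)
      rintro y ⟨n, h, u, rfl⟩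
      rcases h.lt_or_eq with h1 | h1
      · exact Or.inl ⟨n, h1, u, rfl⟩
      · subst h1
        exact Or.inr ⟨u, (projIter_self V lam _ _).symm⟩
    rw [closure_union, (Set.finite_range _).isClosed.closure_eq] at hcl
    obtain ⟨y, ⟨n, h, u, rfl⟩, hy⟩ := dOne_close (hcl.resolve_right hpF) (half_pos hε)
    refine ⟨n, h, u, ?_⟩
    have h3 := dOne_triangle (projIter V lam h.le (vert V u)) p (vert V v)
    rw [dOne_vert V v hpm, hpv] at h3
    linarith
  · push Not at hc
    obtain ⟨w⟩ := (inferInstance : Nonempty (V (m + 1)))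
    refine ⟨m + 1, Nat.lt_succ_self m, w, ?_⟩
    have hm := projIter_mem V lam hpos hsum (Nat.lt_succ_self m).le (vert_mem V w)
    rw [dOne_vert V v hm]
    have h2 := hm.2
    rw [Finset.sum_eq_single v (fun b _ hb => absurd (hc b) hb) (by simp)] at h2
    rw [h2]
    simpa using hε

lemma extreme_of_near
    (hpos : ∀ n (v : V (n + 1)) (u : V n), 0 ≤ lam n v u)
    (hsum : ∀ n (v : V (n + 1)), ∑ u, lam n v u = 1)
    {y : ∀ n, V n → ℝ} (hy : y ∈ SigmaInf V lam)
    (H : ∀ j : ℕ, ∀ δ : ℝ, 0 < δ → ∃ n, j ≤ n ∧ ∃ v : V n, dOne (y n) (vert V v) ≤ δ) :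
    y ∈ Set.extremePoints ℝ (SigmaInf V lam) := by
  rw [mem_extremePoints_iff_left]
  refine ⟨hy, ?_⟩
  rintro a ha b hb ⟨s, t, hs, ht, hst, rfl⟩
  set y := s • a + t • b with hydef
  funext j
  have key : ∀ δ : ℝ, 0 < δ → s * dOne (a j) (y j) ≤ 0 + δ := by
    intro δ hδ
    obtain ⟨n, hjn, v, hv⟩ := H j (δ / 2) (half_pos hδ)
    have h1 : dOne (a j) (y j) ≤ dOne (a n) (y n) := by
      rw [← projIter_sigma V lam ha hjn, ← projIter_sigma V lam hy hjn]
      exact projIter_dOne V lam hpos hsum hjn _ _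
    have h2 := dOne_triangle (a n) (vert V v) (y n)
    rw [dOne_comm (vert V v)] at h2
    have h3 : s * dOne (a n) (vert V v) ≤ dOne (y n) (vert V v) := by
      rw [dOne_vert V v (ha.1 n), dOne_vert V v (hy.1 n)]
      have hyv : y n v = s * a n v + t * b n v := by simp [hydef]
      have hb1 : b n v ≤ 1 := (mem_Icc_of_mem_stdSimplex (hb.1 n) v).2
      rw [hyv]
      nlinarith
    have h4 := mul_le_mul_of_nonneg_left (h1.trans h2) hs.le
    have h5 : s * dOne (y n) (vert V v) ≤ 1 * dOne (y n) (vert V v) :=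
      mul_le_mul_of_nonneg_right (by linarith) (dOne_nonneg _ _)
    linarith
  have h0 : s * dOne (a j) (y j) ≤ 0 := le_of_forall_pos_le_add key
  have h1 : dOne (a j) (y j) ≤ 0 := by
    by_contra hcon
    push Not at hcon
    have := mul_pos hs hcon
    linarith
  funext u
  have h2 := (abs_le_dOne (a j) (y j) u).trans h1
  exact sub_eq_zero.1 (abs_nonpos_iff.1 h2)

lemma exists_extreme_near
    (hpos : ∀ n (v : V (n + 1)) (u : V n), 0 ≤ lam n v u)
    (hsum : ∀ n (v : V (n + 1)), ∑ u, lam n v u = 1)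
    [∀ n, Nonempty (V n)]
    (hdense : ∀ m : ℕ, stdSimplex ℝ (V m) ⊆
      closure {y : V m → ℝ | ∃ n, ∃ h : m ≤ n, ∃ v : V n, y = projIter V lam h (vert V v)})
    (m : ℕ) {x : V m → ℝ} (hx : x ∈ stdSimplex ℝ (V m)) {ε : ℝ} (hε : 0 < ε) :
    ∃ y ∈ Set.extremePoints ℝ (SigmaInf V lam), dOne (y m) x ≤ 2 * ε := by
  obtain ⟨_, ⟨n0, hn0, v0, rfl⟩, hv0⟩ := dOne_close (hdense m hx) hε
  -- the recursive choice
  have hstep : ∀ (k : ℕ) (p : Σ n, V n), ∃ q : Σ n, V n, ∃ h : p.1 < q.1,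
      dOne (projIter V lam h.le (vert V q.2)) (vert V p.2) < ε / 2 ^ (k + 1) := by
    intro k p
    obtain ⟨n, h, w, hw⟩ := later_vert V lam hpos hsum hdense p.1 p.2
      (ε := ε / 2 ^ (k + 1)) (by positivity)
    exact ⟨⟨n, w⟩, h, hw⟩
  choose nxt hlt hnxt using hstep
  let s : ℕ → Σ n, V n := fun k => Nat.rec ⟨n0, v0⟩ (fun k p => nxt k p) k
  have hs0 : s 0 = ⟨n0, v0⟩ := rfl
  have hss : ∀ k, s (k + 1) = nxt k (s k) := fun k => rfl
  have hmono : StrictMono fun k => (s k).1 := strictMono_nat_of_lt_succ fun k => hlt k (s k)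
  have hle : ∀ {k l : ℕ}, k ≤ l → (s k).1 ≤ (s l).1 := fun h => hmono.monotone h
  have hnear : ∀ k l (h : k ≤ l), dOne (projIter V lam (hle h) (vert V (s l).2))
      (vert V (s k).2) ≤ ε / 2 ^ k - ε / 2 ^ l := by
    intro k l h
    induction l, h using Nat.le_induction with
    | base => rw [projIter_self, dOne_self]; simp
    | succ l hl ih =>
      have h1 : dOne (projIter V lam (hle (Nat.le_succ l)) (vert V (s (l + 1)).2))
        (vert V (s l).2) < ε / 2 ^ (l + 1) := hnxt l (s l)
      have h2 := projIter_dOne V lam hpos hsum (hle hl)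
        (projIter V lam (hle (Nat.le_succ l)) (vert V (s (l + 1)).2)) (vert V (s l).2)
      rw [← projIter_trans] at h2
      have h3 := dOne_triangle (projIter V lam (hle (hl.trans (Nat.le_succ l)))
        (vert V (s (l + 1)).2)) (projIter V lam (hle hl) (vert V (s l).2)) (vert V (s k).2)
      have h4 : ε / 2 ^ l = 2 * (ε / 2 ^ (l + 1)) := by
        rw [pow_succ]; field_simp
      linarith
  -- approximating points
  let Z : ℕ → ∀ j, V j → ℝ := fun k j =>
    if h : j ≤ (s k).1 then projIter V lam h (vert V (s k).2)
    else vert V (Classical.arbitrary (V j))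
  have hZ : ∀ k j (h : j ≤ (s k).1), Z k j = projIter V lam h (vert V (s k).2) :=
    fun k j h => dif_pos h
  have hcomp : IsCompact (Set.pi Set.univ fun j => stdSimplex ℝ (V j)) :=
    isCompact_univ_pi fun j => isCompact_stdSimplex ℝ (V j)
  have hZm : ∀ k, Z k ∈ Set.pi Set.univ fun j => stdSimplex ℝ (V j) := by
    intro k j _
    by_cases h : j ≤ (s k).1
    · rw [hZ k j h]
      exact projIter_mem V lam hpos hsum h (vert_mem V _)
    · have : Z k j = vert V (Classical.arbitrary (V j)) := dif_neg h
      rw [this]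
      exact vert_mem V _
  obtain ⟨y, hyS, φ, hφ, hlim⟩ := hcomp.tendsto_subseq hZm
  have hlimj : ∀ j, Filter.Tendsto (fun k => Z (φ k) j) Filter.atTop (nhds (y j)) :=
    fun j => tendsto_pi_nhds.1 hlim j
  have hge : ∀ k, k ≤ (s (φ k)).1 := fun k => (hφ.id_le k).trans (hmono.id_le (φ k))
  have hy : y ∈ SigmaInf V lam := by
    refine ⟨fun n => hyS n (Set.mem_univ n), fun n => ?_⟩
    have hc : Continuous (projStep V lam n) := by
      unfold projStep
      fun_prop
    refine tendsto_nhds_unique_of_eventuallyEq ((hc.tendsto _).comp (hlimj (n + 1)))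
      (hlimj n) ?_
    filter_upwards [Filter.eventually_ge_atTop (n + 1)] with k hk
    have h1 : n + 1 ≤ (s (φ k)).1 := hk.trans (hge k)
    simp only [Function.comp]
    rw [hZ _ _ h1, hZ _ _ ((Nat.le_succ n).trans h1), projIter_step]
  have hynear : ∀ k, dOne (y (s k).1) (vert V (s k).2) ≤ ε / 2 ^ k := by
    intro k
    refine le_of_tendsto (((dOne_continuous _).tendsto _).comp (hlimj (s k).1)) ?_
    filter_upwards [Filter.eventually_ge_atTop k] with l hl
    have h1 : k ≤ φ l := hl.trans (hφ.id_le l)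
    simp only [Function.comp]
    rw [hZ _ _ (hle h1)]
    have h2 := hnear k (φ l) h1
    have h3 : 0 < ε / 2 ^ (φ l) := by positivity
    linarith
  refine ⟨y, extreme_of_near V lam hpos hsum hy ?_, ?_⟩
  · intro j δ hδ
    have ht : Filter.Tendsto (fun k : ℕ => ε / 2 ^ k) Filter.atTop (nhds 0) := by
      have := (tendsto_pow_atTop_nhds_zero_of_lt_one (r := (1 / 2 : ℝ)) (by norm_num)
        (by norm_num)).const_mul ε
      simpa [div_eq_mul_inv] using this
    obtain ⟨k, hk1, hk2⟩ := ((ht.eventually_lt_const hδ).and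
      (Filter.eventually_ge_atTop j)).exists
    exact ⟨(s k).1, hk2.trans (hmono.id_le k), (s k).2, (hynear k).trans hk1.le⟩
  · have h1 := hynear 0
    rw [hs0] at h1
    simp only [pow_zero, div_one] at h1
    have h2 := projIter_dOne V lam hpos hsum hn0 (y n0) (vert V v0)
    rw [projIter_sigma V lam hy] at h2
    have h3 := dOne_triangle (y m) (projIter V lam hn0 (vert V v0)) x
    linarith

end Helpers

/-- if for every `m` the images `π[n,m] (e v)` of the vertices of all later
levels are dense in `stdSimplex ℝ (V m)`, then the extreme points of `Σ∞` are dense in `Σ∞`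
(so `Σ∞` is a Poulsen simplex). -/
theorem poulsen_of_dense_vertex_images
    (V : ℕ → Type) [∀ n, Fintype (V n)] [∀ n, Nonempty (V n)] [∀ n, DecidableEq (V n)]
    (lam : ∀ n, V (n + 1) → V n → ℝ)
    (hpos : ∀ n (v : V (n + 1)) (u : V n), 0 ≤ lam n v u)
    (hsum : ∀ n (v : V (n + 1)), ∑ u, lam n v u = 1)
    (hdense : ∀ m : ℕ, stdSimplex ℝ (V m) ⊆
      closure {y : V m → ℝ | ∃ n, ∃ h : m ≤ n, ∃ v : V n, y = projIter V lam h (vert V v)}) :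
    SigmaInf V lam ⊆ closure (Set.extremePoints ℝ (SigmaInf V lam)) := by
  intro x hx
  have hex : ∀ N : ℕ, ∃ y ∈ Set.extremePoints ℝ (SigmaInf V lam),
      dOne (y N) (x N) ≤ 2 * (1 / ((N : ℝ) + 1)) := fun N =>
    exists_extreme_near V lam hpos hsum hdense N (hx.1 N) (by positivity)
  choose Y hY hYd using hex
  refine mem_closure_of_tendsto (f := Y) (b := Filter.atTop) ?_ (Filter.Eventually.of_forall hY)
  rw [tendsto_pi_nhds]
  intro j
  rw [tendsto_pi_nhds]
  intro u
  rw [tendsto_iff_dist_tendsto_zero]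
  have ht : Filter.Tendsto (fun N : ℕ => 2 * (1 / ((N : ℝ) + 1))) Filter.atTop (nhds 0) := by
    simpa using (tendsto_one_div_add_atTop_nhds_zero_nat (𝕜 := ℝ)).const_mul 2
  refine squeeze_zero' (Filter.Eventually.of_forall fun _ => dist_nonneg) ?_ ht
  filter_upwards [Filter.eventually_ge_atTop j] with N hN
  rw [Real.dist_eq]
  refine (abs_le_dOne (Y N j) (x j) u).trans (le_trans ?_ (hYd N))
  rw [← projIter_sigma V lam (hY N).1 hN, ← projIter_sigma V lam hx hN]
  exact projIter_dOne V lam hpos hsum hN _ _
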